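/- Let s ≥ 1 and t be integers with n = 2s and m = s + t, where 1 ≤ m ≤ n. If t lies in the open interval ((1 − √(1+8s))/2, (1 + √(1+8s))/2) (equivalently, t² − t − 2s < 0), then h(n,m) = s. -/

import Mathlib

/-- The generalized binomial coefficient `C(a,k) = a(a-1)⋯(a-k+1)/k!` for an integer `a`
and natural number `k`, as a rational number. -/
def genChoose (a : ℤ) (k : ℕ) : ℚ :=
  (∏ i ∈ Finset.range k, ((a : ℚ) - i)) / (Nat.factorial k)

/-- `hNM n m` is the maximum of the set of `q ∈ ℕ` with `q ≤ n + m` such that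
`C(q-n, 2ℓ) + C(q-m, 2ℓ) ≥ C(q, 2ℓ)` for all integers `ℓ` with `1 ≤ ℓ ≤ ⌊q/2⌋`.
For `n ≥ m ≥ 1` it equals the Hilbert depth of `S_{n,m}/I_{n,m}`. -/
noncomputable def hNM (n m : ℕ) : ℕ :=
  sSup {q : ℕ | q ≤ n + m ∧ ∀ ℓ : ℕ, 1 ≤ ℓ → ℓ ≤ q / 2 →
    genChoose (q : ℤ) (2 * ℓ) ≤
      genChoose ((q : ℤ) - n) (2 * ℓ) + genChoose ((q : ℤ) - m) (2 * ℓ)}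

theorem genChoose_two (a : ℤ) : genChoose a 2 = (a : ℚ) * (a - 1) / 2 := by
  simp [genChoose, Finset.prod_range_succ]

theorem genChoose_natCast (a k : ℕ) : genChoose a k = (a.choose k : ℚ) := by
  rw [genChoose, div_eq_iff (by positivity), Int.cast_natCast,
    ← descPochhammer_eval_eq_prod_range, descPochhammer_eval_eq_descFactorial,
    Nat.descFactorial_eq_factorial_mul_choose]
  push_cast
  ring

theorem genChoose_natCast_nonneg (a k : ℕ) : 0 ≤ genChoose a k := by
  rw [genChoose_natCast]
  positivity

/-- For a nonpositive upper index and an even lower index all signs cancel. -/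
theorem genChoose_neg_natCast_two_mul (a k : ℕ) :
    genChoose (-(a : ℤ)) (2 * k) =
      (∏ i ∈ Finset.range (2 * k), ((a : ℚ) + i)) / (Nat.factorial (2 * k)) := by
  have h (i : ℕ) : ((-(a : ℤ) : ℤ) : ℚ) - i = (-1) * ((a : ℚ) + i) := by
    push_cast
    ring
  simp only [genChoose, h, Finset.prod_mul_distrib, Finset.prod_const, Finset.card_range,
    even_two_mul, Even.neg_one_pow, one_mul]

theorem genChoose_two_mul_nonneg (a : ℤ) (k : ℕ) : 0 ≤ genChoose a (2 * k) := by
  obtain ⟨b, rfl | rfl⟩ := a.eq_nat_or_neg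
  · exact genChoose_natCast_nonneg b _
  · rw [genChoose_neg_natCast_two_mul]
    positivity

theorem genChoose_natCast_le_neg (a k : ℕ) :
    genChoose a (2 * k) ≤ genChoose (-(a : ℤ)) (2 * k) := by
  rw [genChoose_neg_natCast_two_mul, genChoose_natCast]
  rcases lt_or_ge a (2 * k) with h | h
  · rw [Nat.choose_eq_zero_of_lt h]
    push_cast
    positivity
  · rw [← genChoose_natCast, genChoose]
    gcongr with i hi
    · intro i hi
      have : (i : ℚ) ≤ a := by
        exact_mod_cast ((Finset.mem_range.mp hi).trans_le h).le
      simpa using this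
    · push_cast
      have : (0 : ℚ) ≤ i := by positivity
      linarith

/-- Past `q = s`, the defining inequality of `hNM (2 * s) (s + t)` fails for `ℓ = 1`. -/
theorem genChoose_two_add_lt {s t q : ℤ} (ht : t ^ 2 - t < 2 * s) (hsq : s < q)
    (hq : q ≤ 3 * s + t) :
    genChoose (q - 2 * s) 2 + genChoose (q - (s + t)) 2 < genChoose q 2 := by
  simp only [genChoose_two]
  have key : (q - 2 * s) * (q - 2 * s - 1) + (q - (s + t)) * (q - (s + t) - 1) < q * (q - 1) := by
    nlinarith [mul_nonneg (by lia : 0 ≤ q - s - 1) (by lia : 0 ≤ 3 * s + t - q),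
      mul_nonneg (by lia : 0 ≤ q - s - 1) (by lia : 0 ≤ 2 * s + t)]
  have key' : (((q - 2 * s) * (q - 2 * s - 1) + (q - (s + t)) * (q - (s + t) - 1) : ℤ) : ℚ) <
      (q * (q - 1) : ℤ) := Int.cast_lt.mpr key
  push_cast at key' ⊢
  linarith

theorem sq_sub_lt_of_mem_sqrt_interval {x y : ℝ} (hy : 0 ≤ 1 + 8 * y)
    (h₁ : (1 - √(1 + 8 * y)) / 2 < x) (h₂ : x < (1 + √(1 + 8 * y)) / 2) :
    x ^ 2 - x < 2 * y := by
  nlinarith [Real.sq_sqrt hy, mul_pos (sub_pos.mpr h₁) (sub_pos.mpr h₂)]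

/-- If n = 2s, m = s + t with 1 ≤ m ≤ n and
t ∈ ((1 − √(1+8s))/2, (1 + √(1+8s))/2), then h(n,m) = s. -/
theorem hNM_eq_of_even (s : ℕ) (hs : 1 ≤ s) (t : ℤ) (n m : ℕ)
    (hn : n = 2 * s) (hm : (m : ℤ) = (s : ℤ) + t) (hm1 : 1 ≤ m) (hmn : m ≤ n)
    (ht1 : (1 - Real.sqrt (1 + 8 * s)) / 2 < (t : ℝ))
    (ht2 : (t : ℝ) < (1 + Real.sqrt (1 + 8 * s)) / 2) :
    hNM n m = s := by
  have ht : t ^ 2 - t < 2 * (s : ℤ) := by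
    exact_mod_cast sq_sub_lt_of_mem_sqrt_interval (by positivity) ht1 ht2
  refine IsGreatest.csSup_eq ⟨⟨by lia, fun ℓ _ _ => ?_⟩, fun q ⟨hq, h⟩ => ?_⟩
  · rw [show (s : ℤ) - n = -(s : ℤ) by lia]
    exact (genChoose_natCast_le_neg s ℓ).trans
      (le_add_of_nonneg_right (genChoose_two_mul_nonneg _ ℓ))
  · by_contra! hsq
    refine (h 1 le_rfl (by lia)).not_gt ?_
    rw [hm, hn]
    exact_mod_cast genChoose_two_add_lt ht (Int.ofNat_lt.mpr hsq) (by lia)
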